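/- arXiv:1611.02108 — 2 statements merged into one kernel-verified Lean document; each statement's English description precedes it below -/
import Mathlib

section
/- Let n be a natural number, let L ⊆ [0,1]^n be a finite union of faces of the cube, and let K = ([0,1]^n × {0}) ∪ (L × [0,1]), equipped with the subspace topology from [0,1]^n × [0,1]. Then for every topological space X, every continuous map g : K → X extends to a continuous map G : [0,1]^n × [0,1] → X agreeing with g on K. -/
/-- The face of the cube `[0,1]^n` determined by a finite set `c` of pairs `(i, b)`:
the set of points `u` with `u i = 1` if `b = true` and `u i = 0` if `b = false`,
for every `(i, b) ∈ c`. -/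
def Face (n : ℕ) (c : Finset (Fin n × Bool)) : Set (Fin n → Set.Icc (0:ℝ) 1) :=
  {u | ∀ p ∈ c, (u p.1 : ℝ) = if p.2 then 1 else 0}

/-- Rescaling of the unit interval that sends `[0, m]` to `0` and `[1 - m, 1]` to `1`
when `0 ≤ m ≤ 1/4`, and is the identity when `m = 0`. -/
noncomputable def snap (m x : ℝ) : Set.Icc (0:ℝ) 1 :=
  Set.projIcc 0 1 zero_le_one ((x - m) * (1 + 4 * m))

lemma continuous_snap : Continuous fun p : ℝ × ℝ => snap p.1 p.2 :=
  continuous_projIcc.comp (by fun_prop)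

lemma snap_zero_left (x : Set.Icc (0:ℝ) 1) : snap 0 x = x := by
  simp [snap]

lemma snap_of_le {m x : ℝ} (hm : 0 ≤ m) (hx : x ≤ m) : (snap m x : ℝ) = 0 := by
  rw [snap, Set.projIcc_of_le_left _ (mul_nonpos_of_nonpos_of_nonneg (by linarith) (by linarith))]

lemma snap_of_one_sub_le {m x : ℝ} (hm : 0 ≤ m) (hm' : m ≤ 1 / 4) (hx : 1 - m ≤ x) :
    (snap m x : ℝ) = 1 := by
  rw [snap, Set.projIcc_of_right_le _ (by nlinarith)]

lemma isClosed_face (n : ℕ) (c : Finset (Fin n × Bool)) : IsClosed (Face n c) := by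
  simp only [Face, Set.ofPred_forall]
  exact isClosed_biInter fun p _ => isClosed_eq (by fun_prop) continuous_const

/-- Snapping a point at distance at most `m` from a face lands in that face. -/
lemma snap_mem_face {n : ℕ} {c : Finset (Fin n × Bool)} {u v : Fin n → Set.Icc (0:ℝ) 1} {m : ℝ}
    (hm : m ≤ 1 / 4) (hv : v ∈ Face n c) (huv : dist u v ≤ m) :
    (fun i => snap m (u i)) ∈ Face n c := by
  rintro ⟨i, b⟩ hp
  have hm0 : 0 ≤ m := dist_nonneg.trans huv
  have hi : |(u i : ℝ) - v i| ≤ m := (dist_le_pi_dist u v i).trans huv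
  have hvi := hv _ hp
  rw [abs_le] at hi
  cases b
  · simp only [Bool.false_eq_true, if_false] at hvi ⊢
    exact snap_of_le hm0 (by linarith)
  · simp only [if_true] at hvi ⊢
    exact snap_of_one_sub_le hm0 hm (by linarith)

/-- The open box over a nonempty finite union of faces is a retract of the cylinder. -/
lemma exists_retraction_open_box {n : ℕ} (S : Finset (Finset (Fin n × Bool)))
    {L : Set (Fin n → Set.Icc (0:ℝ) 1)} (hL : L = ⋃ c ∈ S, Face n c) (hne : L.Nonempty) :
    ∃ r : (Fin n → Set.Icc (0:ℝ) 1) × Set.Icc (0:ℝ) 1 →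
        (Fin n → Set.Icc (0:ℝ) 1) × Set.Icc (0:ℝ) 1,
      Continuous r ∧ (∀ p, ((r p).2 : ℝ) = 0 ∨ (r p).1 ∈ L) ∧
        ∀ p, ((p.2 : ℝ) = 0 ∨ p.1 ∈ L) → r p = p := by
  have hclosed : IsClosed L := by
    rw [hL]
    exact S.finite_toSet.isClosed_biUnion fun c _ => isClosed_face n c
  let m : (Fin n → Set.Icc (0:ℝ) 1) × Set.Icc (0:ℝ) 1 → ℝ :=
    fun p => min ((p.2 : ℝ) / 4) (Metric.infDist p.1 L)
  have hm : Continuous m :=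
    (by fun_prop : Continuous fun p : (Fin n → Set.Icc (0:ℝ) 1) × Set.Icc (0:ℝ) 1 =>
      (p.2 : ℝ) / 4).min ((Metric.continuous_infDist_pt L).comp continuous_fst)
  refine ⟨fun p => (fun i => snap (m p) (p.1 i),
    Set.projIcc 0 1 zero_le_one ((p.2 : ℝ) - 4 * m p)), ?_, ?_, ?_⟩
  · refine (continuous_pi fun i => ?_).prodMk (continuous_projIcc.comp (by fun_prop))
    exact continuous_snap.comp (hm.prodMk (by fun_prop))
  · intro p
    rcases le_total ((p.2 : ℝ) / 4) (Metric.infDist p.1 L) with h | h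
    · left
      have hmp : m p = (p.2 : ℝ) / 4 := min_eq_left h
      simp only [hmp]
      rw [Set.projIcc_of_le_left _ (by linarith)]
    · right
      have hmp : m p = Metric.infDist p.1 L := min_eq_right h
      obtain ⟨v, hvL, hv⟩ := hclosed.isCompact.exists_infDist_eq_dist hne p.1
      rw [hL] at hvL ⊢
      simp only [Set.mem_iUnion] at hvL ⊢
      obtain ⟨c, hc, hvc⟩ := hvL
      have h1 := p.2.2.2
      exact ⟨c, hc, snap_mem_face (by linarith) hvc (by rw [hmp, hv])⟩
  · intro p hp
    have hmp : m p = 0 := by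
      rcases hp with h | h
      · simp [m, h, Metric.infDist_nonneg]
      · simp only [m, Metric.infDist_zero_of_mem h]
        exact min_eq_right (div_nonneg p.2.2.1 (by norm_num))
    simp [hmp, snap_zero_left]


/-- If `L ⊆ [0,1]^n` is a finite union of faces and
`K = ([0,1]^n × {0}) ∪ (L × [0,1])`, then every continuous map from `K` to a
topological space `X` extends to a continuous map on the whole cylinder. -/
theorem extend_from_open_box (n : ℕ) (L : Set (Fin n → Set.Icc (0:ℝ) 1))
    (hL : ∃ S : Finset (Finset (Fin n × Bool)), L = ⋃ c ∈ S, Face n c)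
    (K : Set ((Fin n → Set.Icc (0:ℝ) 1) × Set.Icc (0:ℝ) 1))
    (hK : K = {p | (p.2 : ℝ) = 0 ∨ p.1 ∈ L})
    (X : Type*) [TopologicalSpace X] (g : K → X) (hg : Continuous g) :
    ∃ G : (Fin n → Set.Icc (0:ℝ) 1) × Set.Icc (0:ℝ) 1 → X,
      Continuous G ∧ ∀ p : K, G p = g p := by
  subst hK
  obtain ⟨S, hS⟩ := hL
  rcases L.eq_empty_or_nonempty with rfl | hne
  · refine ⟨fun p => g ⟨(p.1, 0), Or.inl rfl⟩, hg.comp (by fun_prop), ?_⟩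
    rintro ⟨⟨u, t⟩, ht | ht⟩
    · obtain rfl : t = 0 := Subtype.ext ht
      rfl
    · exact ht.elim
  · obtain ⟨r, hr, hmem, hfix⟩ := exists_retraction_open_box S hS hne
    refine ⟨fun p => g ⟨r p, hmem p⟩, hg.comp (hr.subtype_mk hmem), fun p => ?_⟩
    exact congrArg g (Subtype.ext (hfix p p.2))
end

section
/- Let N be a type of names, with B(i,b), the collection 𝔽 of subsets of (N → Option Bool), and the operation ∀i.φ defined as follows: B(i,b) = {g : N → Option Bool | g i = some b}; 𝔽 is the smallest collection of subsets containing the empty set, the full set, and every B(i,b), and closed under binary union and binary intersection; and ∀i.φ = {g | Function.update g i none ∈ φ}. Fix a name i, and suppose ψ belongs to the smallest collection of subsets containing the empty set, the full set, and every B(j,b) with j ≠ i, and closed under binary union and binary intersection. Then for every φ ∈ 𝔽: ψ ⊆ φ if and only if ψ ⊆ ∀i.φ. -/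
/-- The face lattice over a type `N` of names, realized concretely: the smallest
collection of subsets of `N → Option Bool` containing the empty set, the full set,
and each generator `{g | g i = some b}`, and closed under binary union and binary
intersection. -/
inductive FaceLat (N : Type*) : Set (N → Option Bool) → Prop
  | empty : FaceLat N ∅
  | full : FaceLat N Set.univ
  | gen (i : N) (b : Bool) : FaceLat N {g | g i = some b}
  | union {φ ψ : Set (N → Option Bool)} :
      FaceLat N φ → FaceLat N ψ → FaceLat N (φ ∪ ψ)
  | inter {φ ψ : Set (N → Option Bool)} :
      FaceLat N φ → FaceLat N ψ → FaceLat N (φ ∩ ψ)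

/-- The part of the face lattice independent of the name `i`: the smallest collection
of subsets of `N → Option Bool` containing the empty set, the full set, and the
generators `{g | g j = some b}` for `j ≠ i`, closed under binary union and binary
intersection. -/
inductive FaceLatAvoid (N : Type*) (i : N) : Set (N → Option Bool) → Prop
  | empty : FaceLatAvoid N i ∅
  | full : FaceLatAvoid N i Set.univ
  | gen (j : N) (b : Bool) : j ≠ i → FaceLatAvoid N i {g | g j = some b}
  | union {φ ψ : Set (N → Option Bool)} :
      FaceLatAvoid N i φ → FaceLatAvoid N i ψ → FaceLatAvoid N i (φ ∪ ψ)
  | inter {φ ψ : Set (N → Option Bool)} :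
      FaceLatAvoid N i φ → FaceLatAvoid N i ψ → FaceLatAvoid N i (φ ∩ ψ)

/-- Membership in a face formula independent of `i` does not depend on the
value at `i`. -/
theorem FaceLatAvoid.update_mem {N : Type*} [DecidableEq N] {i : N}
    {ψ : Set (N → Option Bool)} (hψ : FaceLatAvoid N i ψ) {g : N → Option Bool}
    (hg : g ∈ ψ) (v : Option Bool) : Function.update g i v ∈ ψ := by
  induction hψ with
  | empty => exact hg
  | full => trivial
  | gen j b hj => simpa [Function.update_of_ne hj] using hg
  | union _ _ ihφ ihψ => exact hg.imp ihφ ihψ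
  | inter _ _ ihφ ihψ => exact ⟨ihφ hg.1, ihψ hg.2⟩

/-- Face formulas are upward closed: if one holds after forgetting the value at `i`, it
already holds before. -/
theorem FaceLat.mem_of_update_none_mem {N : Type*} [DecidableEq N] {i : N}
    {φ : Set (N → Option Bool)} (hφ : FaceLat N φ) {g : N → Option Bool}
    (hg : Function.update g i none ∈ φ) : g ∈ φ := by
  induction hφ with
  | empty => exact hg
  | full => trivial
  | gen j b =>
    by_cases hj : j = i
    · subst hj
      simp at hg
    · simpa [Function.update_of_ne hj] using hg
  | union _ _ ihφ ihψ => exact hg.imp ihφ ihψ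
  | inter _ _ ihφ ihψ => exact ⟨ihφ hg.1, ihψ hg.2⟩

/-- Quantifier elimination for the face lattice: if `ψ` is independent of the name
`i`, then `ψ ≤ φ` if and only if `ψ ≤ ∀i.φ`. -/
theorem faceLat_forall_quantifier_elim (N : Type*) [DecidableEq N] (i : N)
    (ψ : Set (N → Option Bool)) (hψ : FaceLatAvoid N i ψ)
    (φ : Set (N → Option Bool)) (hφ : FaceLat N φ) :
    ψ ⊆ φ ↔ ψ ⊆ {g | Function.update g i none ∈ φ} := by
  exact ⟨fun h _ hg => h (hψ.update_mem hg none),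
    fun h _ hg => hφ.mem_of_update_none_mem (h hg)⟩
end
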